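/- Let K ≥ 1 be a fixed integer. For the random walk on the spider SP(K), almost surely liminf_{n→∞} ( (log log n)/n )^{1/2} · M_K(n) = π/√8, where M_K(n) = max_{1 ≤ j ≤ K} M_K(n,j) is the maximal height reached on any leg in the first n steps. -/

import Mathlib

open MeasureTheory Filter

/-- The vertex set of the spider `SP(N)`: the body, and points on the legs.
`leg r j` denotes the vertex of height `r + 1` on leg `j`. -/
inductive SpiderV (N : ℕ) where
  | body : SpiderV N
  | leg : ℕ → Fin N → SpiderV N
deriving DecidableEq

instance (N : ℕ) : MeasurableSpace (SpiderV N) := ⊤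

/-- The one-step transition probabilities of the random walk on the spider `SP(N)`:
from the body it moves to height `1` of each leg with probability `1/N`; from a vertex
of height `r ≥ 1` on a leg it moves up or down that leg with probability `1/2` each
(height `0` being the body). -/
noncomputable def spiderKernel (N : ℕ) : SpiderV N → SpiderV N → ENNReal
  | .body, .leg 0 _ => 1 / N
  | .leg 0 _, .body => 1 / 2
  | .leg r j, .leg r' j' => if j = j' ∧ (r' = r + 1 ∨ r = r' + 1) then 1 / 2 else 0
  | _, _ => 0

/-- The height of a vertex of the spider: the body has height `0` and `leg r j` has
height `r + 1`. -/
def spiderHeight {N : ℕ} : SpiderV N → ℕ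
  | .body => 0
  | .leg r _ => r + 1

/-! ### The survival function of the reflected walk -/

/-- One step averaging operator of the height process. -/
noncomputable def spStep (f : ℕ → ℝ) : ℕ → ℝ
  | 0 => f 1
  | h + 1 => (f (h + 2) + f h) / 2

/-- Probability that the height process started at `h` stays below `a` for `n` steps. -/
noncomputable def spSurv (a : ℕ) : ℕ → ℕ → ℝ
  | 0, h => if h < a then 1 else 0
  | n + 1, h => if h < a then spStep (spSurv a n) h else 0

lemma spSurv_of_ge {a n h : ℕ} (hh : a ≤ h) : spSurv a n h = 0 := by
  cases n <;> simp [spSurv, not_lt.mpr hh]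

lemma spStep_mono {f g : ℕ → ℝ} {a h : ℕ} (hh : h < a) (H : ∀ x ≤ a, f x ≤ g x) :
    spStep f h ≤ spStep g h := by
  cases h with
  | zero => exact H 1 (by omega)
  | succ h =>
    have h1 := H (h + 2) (by omega)
    have h2 := H h (by omega)
    simp only [spStep]; linarith

lemma spSurv_nonneg (a n h : ℕ) : 0 ≤ spSurv a n h := by
  induction n generalizing h with
  | zero => simp only [spSurv]; split_ifs <;> norm_num
  | succ n ih =>
    simp only [spSurv]
    split_ifs with hh
    · cases h with
      | zero => exact ih 1
      | succ h =>
        have h1 := ih (h + 2)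
        have h2 := ih h
        simp only [spStep]; linarith
    · exact le_rfl

lemma spSurv_le_one (a n h : ℕ) : spSurv a n h ≤ 1 := by
  induction n generalizing h with
  | zero => simp only [spSurv]; split_ifs <;> norm_num
  | succ n ih =>
    simp only [spSurv]
    split_ifs with hh
    · cases h with
      | zero => exact ih 1
      | succ h =>
        have h1 := ih (h + 2)
        have h2 := ih h
        simp only [spStep]; linarith
    · exact zero_le_one

lemma spStep_cos (t C : ℝ) (h : ℕ) :
    spStep (fun x => C * Real.cos (t * x)) h = C * (Real.cos t * Real.cos (t * h)) := by
  cases h with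
  | zero => simp [spStep]
  | succ h =>
    simp only [spStep]
    push_cast
    have e1 : t * ((h : ℝ) + 2) = t * (h + 1) + t := by ring
    have e2 : t * (h : ℝ) = t * (h + 1) - t := by ring
    rw [e1, e2, Real.cos_add, Real.cos_sub]
    have : t * (h + 1) - t + t = t * (h + 1) := by ring
    ring_nf

lemma spSurv_le (a n : ℕ) (ha : 0 < a) (t : ℝ) (ht : 0 ≤ t) (hta : t * a < Real.pi / 2) (h : ℕ) (hh : h ≤ a) :
    spSurv a n h ≤ Real.cos t ^ n / Real.cos (t * a) * Real.cos (t * h) := by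
  have hpos : ∀ x : ℕ, x ≤ a → 0 < Real.cos (t * x) := by
    intro x hx
    apply Real.cos_pos_of_mem_Ioo
    have h1 : t * x ≤ t * a := by gcongr
    have h2 : 0 ≤ t * (x : ℝ) := by positivity
    exact ⟨by linarith [Real.pi_pos], by linarith⟩
  have hca := hpos a le_rfl
  induction n generalizing h with
  | zero =>
    simp only [spSurv, pow_zero]
    split_ifs with h1
    · rw [div_mul_eq_mul_div, one_mul, le_div_iff₀ hca, one_mul]
      apply Real.cos_le_cos_of_nonneg_of_le_pi
      · positivity
      · linarith [Real.pi_pos]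
      · gcongr
    · have := hpos h hh
      positivity
  | succ n ih =>
    have hct : 0 ≤ Real.cos t := by simpa using (hpos 1 ha).le
    simp only [spSurv]
    split_ifs with h1
    · refine (spStep_mono h1 ih).trans ?_
      rw [spStep_cos]
      apply le_of_eq; ring
    · have := hpos h hh
      positivity

lemma le_spSurv (a n : ℕ) (ha : 0 < a) (h : ℕ) (hh : h ≤ a) :
    Real.cos (Real.pi / 2 / a) ^ n * Real.cos (Real.pi / 2 / a * h) ≤ spSurv a n h := by
  have ha' : (0 : ℝ) < a := by exact_mod_cast ha
  induction n generalizing h with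
  | zero =>
    simp only [spSurv, pow_zero, one_mul]
    split_ifs with h1
    · exact Real.cos_le_one _
    · have : h = a := by omega
      subst this
      rw [div_mul_cancel₀ _ ha'.ne', Real.cos_pi_div_two]
  | succ n ih =>
    simp only [spSurv]
    split_ifs with h1
    · refine le_trans ?_ (spStep_mono h1 ih)
      rw [spStep_cos]
      apply le_of_eq; ring
    · have : h = a := by omega
      subst this
      rw [div_mul_cancel₀ _ ha'.ne', Real.cos_pi_div_two]
      simp

lemma one_sub_spSurv_le (a n : ℕ) (ha : 0 < a) (h : ℕ) :
    1 - spSurv a n h ≤ ((h : ℝ) ^ 2 + n) / a ^ 2 := by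
  have ha' : (0 : ℝ) < a := by exact_mod_cast ha
  have key : ∀ m h : ℕ, a ≤ h → (1 : ℝ) ≤ ((h : ℝ) ^ 2 + m) / a ^ 2 := by
    intro m h hh
    rw [le_div_iff₀ (by positivity)]
    have : (a : ℝ) ≤ h := by exact_mod_cast hh
    have : (0 : ℝ) ≤ m := by positivity
    nlinarith
  induction n generalizing h with
  | zero =>
    simp only [spSurv]
    split_ifs with h1
    · simp; positivity
    · simpa using key 0 h (by omega)
  | succ n ih =>
    simp only [spSurv]
    split_ifs with h1
    · cases h with
      | zero =>
        have := ih 1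
        simp only [spStep]
        refine this.trans (le_of_eq ?_)
        push_cast; ring
      | succ h =>
        have e1 := ih (h + 2)
        have e2 := ih h
        simp only [spStep]
        have : 1 - (spSurv a n (h + 2) + spSurv a n h) / 2
            ≤ ((((h + 2 : ℕ) : ℝ) ^ 2 + n) / a ^ 2 + ((h : ℝ) ^ 2 + n) / a ^ 2) / 2 := by linarith
        refine this.trans (le_of_eq ?_)
        push_cast; ring
    · simpa using key (n + 1) h (by omega)

lemma cos_le_exp_neg {x : ℝ} (hx : |x| ≤ 1) : Real.cos x ≤ Real.exp (-(x ^ 2 / 2)) := by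
  have h1 := (abs_le.mp (Real.cos_bound hx)).2
  have h2 : Real.exp (-(x ^ 2 / 2)) = Real.exp (-(x ^ 2 / 4)) ^ 2 := by
    rw [← Real.exp_nat_mul]; congr 1; push_cast; ring
  have h3 := Real.add_one_le_exp (-(x ^ 2 / 4))
  have h4 : x ^ 2 ≤ 1 := by rw [← sq_abs]; nlinarith [abs_nonneg x]
  have h5 : |x| ^ 4 = x ^ 4 := by rw [show (4 : ℕ) = 2 * 2 by norm_num, pow_mul, sq_abs, ← pow_mul]
  rw [h5] at h1
  rw [h2]
  have h6 : (1 - x ^ 2 / 4) ^ 2 ≤ Real.exp (-(x ^ 2 / 4)) ^ 2 := by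
    apply pow_le_pow_left₀ <;> linarith
  nlinarith [sq_nonneg (x ^ 2)]

lemma exp_neg_le_cos {x e : ℝ} (he : 0 < e) (hx : x ^ 2 / 2 * (1 + e) ≤ e) :
    Real.exp (-((1 + e) * (x ^ 2 / 2))) ≤ Real.cos x := by
  have h1 := Real.one_sub_sq_div_two_le_cos (x := x)
  refine le_trans ?_ h1
  set y := x ^ 2 / 2 with hy
  have hy0 : 0 ≤ y := by positivity
  have h2 := Real.add_one_le_exp ((1 + e) * y)
  rw [Real.exp_neg, inv_le_comm₀ (Real.exp_pos _) (by nlinarith)]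
  refine le_trans ?_ h2
  rw [inv_le_iff_one_le_mul₀ (by nlinarith)]
  nlinarith [mul_nonneg hy0 (sub_nonneg.mpr hx)]

set_option linter.unusedSectionVars false

/-! ### The Markov property -/

instance (N : ℕ) : Countable (SpiderV N) := by
  let f : SpiderV N → Option (ℕ × Fin N) := fun v => match v with
    | .body => none
    | .leg r j => some (r, j)
  refine Function.Injective.countable (f := f) ?_
  intro v w h
  cases v <;> cases w <;> simp_all [f]

instance (N : ℕ) : DiscreteMeasurableSpace (SpiderV N) := ⟨fun _ => trivial⟩

lemma spiderKernel_tsum (K : ℕ) (hK : 1 ≤ K) (f : ℕ → ℝ) (hf : ∀ x, 0 ≤ f x) (v : SpiderV K) :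
    ∑' w, ENNReal.ofReal (f (spiderHeight w)) * spiderKernel K v w
      = ENNReal.ofReal (spStep f (spiderHeight v)) := by
  have hhalf : ENNReal.ofReal (1 / 2) = 1 / 2 := by
    rw [ENNReal.ofReal_div_of_pos two_pos]; simp
  cases v with
  | body =>
    rw [tsum_eq_sum (s := Finset.univ.image (fun j : Fin K => SpiderV.leg 0 j))]
    · rw [Finset.sum_image (by intro a _ b _ h; simpa using h)]
      simp only [spiderHeight, spiderKernel, spStep, Finset.sum_const, Finset.card_univ,
        Fintype.card_fin, nsmul_eq_mul, zero_add]
      have hK0 : (K : ENNReal) ≠ 0 := by simp; omega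
      rw [mul_left_comm, one_div, ENNReal.mul_inv_cancel hK0 (ENNReal.natCast_ne_top K), mul_one]
    · intro w hw
      rcases w with _ | ⟨_ | r, j⟩
      · simp [spiderKernel]
      · simp at hw
      · simp [spiderKernel]
  | leg r j =>
    cases r with
    | zero =>
      rw [tsum_eq_sum (s := {SpiderV.body, SpiderV.leg 1 j})]
      · rw [Finset.sum_pair (by simp)]
        simp only [spiderHeight, spiderKernel, spStep]
        simp only [zero_add, true_or, and_self, if_true]
        rw [← add_mul, ← ENNReal.ofReal_add (hf _) (hf _), ← hhalf,
          ← ENNReal.ofReal_mul (add_nonneg (hf _) (hf _))]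
        congr 1; ring
      · intro w hw
        rcases w with _ | ⟨r, j'⟩
        · simp at hw
        · have : ¬ (j = j' ∧ (r = 0 + 1 ∨ 0 = r + 1)) := by
            rintro ⟨rfl, h⟩
            simp at hw
            omega
          simp only [spiderKernel, if_neg this, mul_zero]
    | succ r =>
      rw [tsum_eq_sum (s := {SpiderV.leg r j, SpiderV.leg (r + 2) j})]
      · rw [Finset.sum_pair (by simp)]
        have h1 : spiderKernel K (SpiderV.leg (r + 1) j) (SpiderV.leg r j) = 1 / 2 := by
          simp [spiderKernel]
        have h2 : spiderKernel K (SpiderV.leg (r + 1) j) (SpiderV.leg (r + 2) j) = 1 / 2 := by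
          simp [spiderKernel]
        rw [h1, h2]
        simp only [spiderHeight, spStep]
        rw [← add_mul, ← ENNReal.ofReal_add (hf _) (hf _), ← hhalf,
          ← ENNReal.ofReal_mul (add_nonneg (hf _) (hf _))]
        congr 1; ring_nf
      · intro w hw
        rcases w with _ | ⟨r', j'⟩
        · simp [spiderKernel]
        · have : ¬ (j = j' ∧ (r' = (r + 1) + 1 ∨ r + 1 = r' + 1)) := by
            rintro ⟨rfl, h⟩
            simp at hw
            omega
          simp only [spiderKernel, if_neg this, mul_zero]

section Walk

variable {K : ℕ} {Ω : Type} [MeasurableSpace Ω] {P : Measure Ω} {W : ℕ → Ω → SpiderV K}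

/-- Cylinder event. -/
def spCyl (W : ℕ → Ω → SpiderV K) (m : ℕ) (h : ℕ → SpiderV K) : Set Ω :=
  {ω | ∀ k ≤ m, W k ω = h k}

/-- The walk stays below height `a` during `[m, m+n]`. -/
def spStay (W : ℕ → Ω → SpiderV K) (a m n : ℕ) : Set Ω :=
  {ω | ∀ t, m ≤ t → t ≤ m + n → spiderHeight (W t ω) < a}

lemma spCyl_meas (hmeas : ∀ n, Measurable (W n)) (m : ℕ) (h : ℕ → SpiderV K) :
    MeasurableSet (spCyl W m h) := by
  have : spCyl W m h = ⋂ k, ⋂ (_ : k ≤ m), W k ⁻¹' {h k} := by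
    ext ω; simp [spCyl]
  rw [this]
  exact MeasurableSet.iInter fun k => MeasurableSet.iInter fun _ =>
    hmeas k (MeasurableSet.of_discrete)

lemma spStay_meas (hmeas : ∀ n, Measurable (W n)) (a m n : ℕ) :
    MeasurableSet (spStay W a m n) := by
  have : spStay W a m n
      = ⋂ k, ⋂ (_ : m ≤ k), ⋂ (_ : k ≤ m + n), W k ⁻¹' {v | spiderHeight v < a} := by
    ext ω; simp [spStay]
  rw [this]
  exact MeasurableSet.iInter fun k => MeasurableSet.iInter fun _ => MeasurableSet.iInter fun _ =>
    hmeas k (MeasurableSet.of_discrete)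

lemma sp_markov (hK : 1 ≤ K) (hmeas : ∀ n, Measurable (W n))
    (hMarkov : ∀ n (h : ℕ → SpiderV K) (w : SpiderV K),
      P ({ω | W (n + 1) ω = w} ∩ {ω | ∀ k ≤ n, W k ω = h k})
        = spiderKernel K (h n) w * P {ω | ∀ k ≤ n, W k ω = h k}) (a n m : ℕ) (h : ℕ → SpiderV K) :
    P (spCyl W m h ∩ spStay W a m n)
      = ENNReal.ofReal (spSurv a n (spiderHeight (h m))) * P (spCyl W m h) := by
  induction n generalizing m h with
  | zero =>
    simp only [spSurv]
    split_ifs with h1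
    · have : spCyl W m h ∩ spStay W a m 0 = spCyl W m h := by
        ext ω
        simp only [spCyl, spStay, Set.mem_inter_iff, Set.mem_ofPred_eq, and_iff_left_iff_imp]
        intro H t h2 h3
        have : t = m := by omega
        subst this
        rw [H t le_rfl]; exact h1
      rw [this]; simp
    · have : spCyl W m h ∩ spStay W a m 0 = ∅ := by
        ext ω
        simp only [spCyl, spStay, Set.mem_inter_iff, Set.mem_ofPred_eq, Set.mem_empty_iff_false,
          iff_false, not_and]
        intro H H2
        have := H2 m le_rfl le_rfl
        rw [H m le_rfl] at this
        exact h1 this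
      rw [this]; simp
  | succ n ih =>
    simp only [spSurv]
    split_ifs with h1
    · have e1 : spCyl W m h ∩ spStay W a m (n + 1)
          = ⋃ w, spCyl W (m + 1) (Function.update h (m + 1) w) ∩ spStay W a (m + 1) n := by
        ext ω
        simp only [spCyl, spStay, Set.mem_inter_iff, Set.mem_ofPred_eq, Set.mem_iUnion]
        constructor
        · rintro ⟨H1, H2⟩
          refine ⟨W (m + 1) ω, ?_, fun t ht1 ht2 => H2 t (by omega) (by omega)⟩
          intro k hk
          rcases eq_or_lt_of_le hk with rfl | hk
          · simp
          · rw [Function.update_of_ne (by omega)]; exact H1 k (by omega)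
        · rintro ⟨w, H1, H2⟩
          have H3 : ∀ k ≤ m, W k ω = h k := by
            intro k hk
            rw [H1 k (by omega), Function.update_of_ne (by omega)]
          refine ⟨H3, fun t ht1 ht2 => ?_⟩
          rcases eq_or_lt_of_le ht1 with rfl | ht1
          · rw [H3 _ le_rfl]; exact h1
          · exact H2 t (by omega) (by omega)
      rw [e1, measure_iUnion]
      · have e2 : ∀ w, P (spCyl W (m + 1) (Function.update h (m + 1) w) ∩ spStay W a (m + 1) n)
            = ENNReal.ofReal (spSurv a n (spiderHeight w)) * spiderKernel K (h m) w
              * P (spCyl W m h) := by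
          intro w
          rw [ih, Function.update_self, mul_assoc]
          congr 1
          rw [spCyl, spCyl, ← hMarkov]
          congr 1
          ext ω
          simp only [Set.mem_inter_iff, Set.mem_ofPred_eq]
          constructor
          · intro H
            refine ⟨by simpa using H (m + 1) le_rfl, fun k hk => ?_⟩
            rw [H k (by omega), Function.update_of_ne (by omega)]
          · rintro ⟨H1, H2⟩ k hk
            rcases eq_or_lt_of_le hk with rfl | hk
            · simpa using H1
            · rw [Function.update_of_ne (by omega)]; exact H2 k (by omega)
        simp_rw [e2]
        rw [ENNReal.tsum_mul_right, spiderKernel_tsum K hK _ (fun x => spSurv_nonneg a n x)]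
      · intro w w' hww
        rw [Function.onFun, Set.disjoint_left]
        rintro ω ⟨H, -⟩ ⟨H', -⟩
        have a1 := H (m + 1) le_rfl
        have a2 := H' (m + 1) le_rfl
        simp only [Function.update_self] at a1 a2
        exact hww (a1.symm.trans a2)
      · intro w
        exact (spCyl_meas hmeas _ _).inter (spStay_meas hmeas _ _ _)
    · have : spCyl W m h ∩ spStay W a m (n + 1) = ∅ := by
        ext ω
        simp only [spCyl, spStay, Set.mem_inter_iff, Set.mem_ofPred_eq, Set.mem_empty_iff_false,
          iff_false, not_and]
        intro H H2
        have := H2 m le_rfl (by omega)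
        rw [H m le_rfl] at this
        exact h1 this
      rw [this]; simp

/-- `A` is determined by the first `m` steps. -/
def spDet (W : ℕ → Ω → SpiderV K) (m : ℕ) (A : Set Ω) : Prop :=
  ∀ ω ω', (∀ k ≤ m, W k ω = W k ω') → ω ∈ A → ω' ∈ A

lemma spDet.decomp {m : ℕ} {A : Set Ω} (hA : spDet W m A) :
    A = ⋃ v : {v : Fin (m + 1) → SpiderV K // ∃ ω ∈ A, ∀ k : Fin (m + 1), W k ω = v k},
      spCyl W m (fun k => v.1 (Fin.ofNat (m + 1) k)) := by
  ext ω
  simp only [Set.mem_iUnion, spCyl, Set.mem_ofPred_eq]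
  constructor
  · intro hω
    refine ⟨⟨fun k => W k ω, ω, hω, fun k => rfl⟩, fun k hk => ?_⟩
    simp [Nat.mod_eq_of_lt (Nat.lt_succ_of_le hk)]
  · rintro ⟨⟨v, ω', hω', H'⟩, H⟩
    refine hA ω' ω (fun k hk => ?_) hω'
    rw [H k hk]
    have := H' (Fin.ofNat (m + 1) k)
    simpa [Nat.mod_eq_of_lt (Nat.lt_succ_of_le hk)] using this

lemma spDet.meas (hmeas : ∀ n, Measurable (W n)) {m : ℕ} {A : Set Ω} (hA : spDet W m A) :
    MeasurableSet A := by
  rw [hA.decomp]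
  exact MeasurableSet.iUnion fun v => spCyl_meas hmeas _ _

lemma sp_markov_lower (hK : 1 ≤ K) (hmeas : ∀ n, Measurable (W n))
    (hMarkov : ∀ n (h : ℕ → SpiderV K) (w : SpiderV K),
      P ({ω | W (n + 1) ω = w} ∩ {ω | ∀ k ≤ n, W k ω = h k})
        = spiderKernel K (h n) w * P {ω | ∀ k ≤ n, W k ω = h k}) (a n m : ℕ) {A : Set Ω}
    (hA : spDet W m A) {p : ℝ} (hp : ∀ ω ∈ A, p ≤ spSurv a n (spiderHeight (W m ω))) :
    ENNReal.ofReal p * P A ≤ P (A ∩ spStay W a m n) := by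
  have hdisj : Pairwise (Function.onFun Disjoint (fun v : {v : Fin (m + 1) → SpiderV K //
      ∃ ω ∈ A, ∀ k : Fin (m + 1), W k ω = v k} =>
      spCyl W m (fun k => v.1 (Fin.ofNat (m + 1) k)))) := by
    intro v v' hv
    rw [Function.onFun, Set.disjoint_left]
    intro ω H H'
    apply hv
    ext k
    have a1 := H k (Nat.lt_succ_iff.mp k.2)
    have a2 := H' k (Nat.lt_succ_iff.mp k.2)
    simp only [Fin.ofNat_eq_cast, Fin.cast_val_eq_self] at a1 a2
    rw [← a1, ← a2]
  have e1 := (congrArg P hA.decomp).trans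
    (measure_iUnion hdisj (fun v => spCyl_meas hmeas _ _))
  have e2 := (congrArg (fun S => P (S ∩ spStay W a m n)) hA.decomp).trans
    ((congrArg P (Set.iUnion_inter _ _)).trans
      (measure_iUnion (fun v v' hv => (hdisj hv).mono Set.inter_subset_left
        Set.inter_subset_left) (fun v => (spCyl_meas hmeas _ _).inter (spStay_meas hmeas _ _ _))))
  rw [e1, e2, ← ENNReal.tsum_mul_left]
  refine ENNReal.tsum_le_tsum fun v => ?_
  rw [sp_markov hK hmeas hMarkov]
  gcongr
  obtain ⟨v, ω, hω, H⟩ := v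
  have := hp ω hω
  have h2 := H (Fin.ofNat (m + 1) m)
  simp only [Fin.ofNat_eq_cast, Fin.val_natCast, Nat.mod_eq_of_lt (Nat.lt_succ_self m)] at h2 ⊢
  rwa [h2] at this

lemma sp_stay_zero [IsProbabilityMeasure P] (hK : 1 ≤ K) (hmeas : ∀ n, Measurable (W n))
    (h0 : ∀ ω, W 0 ω = SpiderV.body)
    (hMarkov : ∀ n (h : ℕ → SpiderV K) (w : SpiderV K),
      P ({ω | W (n + 1) ω = w} ∩ {ω | ∀ k ≤ n, W k ω = h k})
        = spiderKernel K (h n) w * P {ω | ∀ k ≤ n, W k ω = h k}) (a n : ℕ) :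
    P (spStay W a 0 n) = ENNReal.ofReal (spSurv a n 0) := by
  have := sp_markov hK hmeas hMarkov a n 0 (fun _ => SpiderV.body)
  have h1 : spCyl W 0 (fun _ => SpiderV.body) = Set.univ := by
    ext ω; simp [spCyl, h0]
  rw [h1] at this
  simpa [spiderHeight] using this

end Walk

/-! ### Asymptotics of the survival probabilities -/

lemma tendsto_loglog : Tendsto (fun x : ℝ => Real.log (Real.log x)) atTop atTop :=
  Real.tendsto_log_atTop.comp Real.tendsto_log_atTop

lemma tendsto_div_loglog : Tendsto (fun x : ℝ => x / Real.log (Real.log x)) atTop atTop := by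
  have h1 : (fun x : ℝ => Real.log (Real.log x)) =o[atTop] (fun x : ℝ => x) :=
    (Real.isLittleO_log_id_atTop.comp_tendsto Real.tendsto_log_atTop).trans
      Real.isLittleO_log_id_atTop
  have h2 := h1.tendsto_div_nhds_zero
  have h3 : Tendsto (fun x : ℝ => Real.log (Real.log x) / x) atTop (nhdsWithin 0 (Set.Ioi 0)) := by
    rw [tendsto_nhdsWithin_iff]
    refine ⟨h2, ?_⟩
    filter_upwards [tendsto_loglog.eventually_gt_atTop 0, eventually_gt_atTop 0] with x hx hx0
    exact div_pos hx hx0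
  have h4 := h3.inv_tendsto_nhdsGT_zero
  refine h4.congr fun x => ?_
  simp

lemma tendsto_spScale {c : ℝ} (hc : 0 < c) :
    Tendsto (fun x : ℝ => c * Real.sqrt (x / Real.log (Real.log x))) atTop atTop :=
  (Real.tendsto_sqrt_atTop.comp tendsto_div_loglog).const_mul_atTop hc

lemma surv_upper {c : ℝ} (hc0 : 0 < c) (hc : c ^ 2 < Real.pi ^ 2 / 8) :
    ∃ γ : ℝ, 1 < γ ∧ ∃ C : ℝ, ∀ᶠ x : ℝ in atTop,
      spSurv ⌈c * Real.sqrt (x / Real.log (Real.log x))⌉₊ ⌈x⌉₊ 0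
        ≤ C * Real.exp (-(γ * Real.log (Real.log x))) := by
  have hpi := Real.pi_pos
  -- choose β
  obtain ⟨β, hβ1, hβ2⟩ : ∃ β, Real.sqrt 2 * c < β ∧ β < Real.pi / 2 := by
    apply exists_between
    rw [← abs_of_pos (show (0 : ℝ) < Real.pi / 2 by positivity)]
    apply lt_of_pow_lt_pow_left₀ 2 (by positivity)
    rw [sq_abs, mul_pow, Real.sq_sqrt (by norm_num)]
    nlinarith
  have hβ0 : 0 < β := lt_trans (by positivity) hβ1
  have hβ3 : 2 * c ^ 2 < β ^ 2 := by
    have := pow_lt_pow_left₀ hβ1 (by positivity) (two_ne_zero)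
    rwa [mul_pow, Real.sq_sqrt (by norm_num)] at this
  obtain ⟨γ, hγ1, hγ2⟩ : ∃ γ, 1 < γ ∧ γ < β ^ 2 / (2 * c ^ 2) := by
    apply exists_between
    rw [lt_div_iff₀ (by positivity)]; linarith
  rw [lt_div_iff₀ (by positivity)] at hγ2
  refine ⟨γ, hγ1, 1 / Real.cos β, ?_⟩
  have hcosβ : 0 < Real.cos β := Real.cos_pos_of_mem_Ioo ⟨by linarith, hβ2⟩
  have hγ0 : 0 < γ := by linarith
  set q := β ^ 2 / (2 * γ * c ^ 2) with hq
  have hq1 : 1 < q := by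
    rw [hq, lt_div_iff₀ (by positivity)]; linarith
  have hy := tendsto_spScale hc0
  have hr : Tendsto (fun y : ℝ => ((⌈y⌉₊ : ℝ) / y) ^ 2) atTop (nhds (1 ^ 2)) :=
    (tendsto_nat_ceil_div_atTop (R := ℝ)).pow 2
  have hr' := hy.eventually (hr.eventually (ge_mem_nhds (show (1 : ℝ) ^ 2 < q by simpa using hq1)))
  filter_upwards [hr', hy.eventually_ge_atTop β, hy.eventually_gt_atTop 0,
    tendsto_loglog.eventually_gt_atTop 0, eventually_gt_atTop 0] with x h1 h2 h3 h4 h5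
  set L := Real.log (Real.log x) with hL
  set y := c * Real.sqrt (x / L) with hydef
  set a := ⌈y⌉₊ with ha
  have hy2 : y ^ 2 = c ^ 2 * (x / L) := by
    rw [hydef, mul_pow, Real.sq_sqrt (by positivity)]
  have hay : y ≤ a := Nat.le_ceil y
  have ha0 : (0 : ℝ) < a := lt_of_lt_of_le h3 hay
  have ha0' : 0 < a := by exact_mod_cast ha0
  have hbound := spSurv_le a ⌈x⌉₊ ha0' (β / a) (by positivity)
    (by rw [div_mul_cancel₀ _ ha0.ne']; exact hβ2) 0 (Nat.zero_le _)
  rw [div_mul_cancel₀ _ ha0.ne'] at hbound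
  simp only [Nat.cast_zero, mul_zero, Real.cos_zero, mul_one] at hbound
  refine hbound.trans ?_
  rw [div_eq_mul_one_div, mul_comm]
  gcongr
  have hb1 : |β / a| ≤ 1 := by
    rw [abs_of_pos (by positivity), div_le_one ha0]; linarith
  have hcosnn : 0 ≤ Real.cos (β / a) := by
    apply Real.cos_nonneg_of_mem_Icc
    have := abs_le.mp hb1
    have := Real.pi_gt_three
    constructor <;> linarith
  have ha2 : (a : ℝ) ^ 2 ≤ β ^ 2 * x / (2 * γ * L) := by
    rw [div_pow, div_le_iff₀ (by positivity), hy2, hq] at h1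
    refine h1.trans (le_of_eq ?_)
    field_simp
  calc Real.cos (β / a) ^ ⌈x⌉₊ ≤ Real.exp (-((β / a) ^ 2 / 2)) ^ ⌈x⌉₊ :=
        pow_le_pow_left₀ hcosnn (cos_le_exp_neg hb1) _
    _ = Real.exp (-(⌈x⌉₊ * ((β / a) ^ 2 / 2))) := by
        rw [← Real.exp_nat_mul]; congr 1; ring
    _ ≤ Real.exp (-(γ * L)) := by
        apply Real.exp_le_exp.mpr
        apply neg_le_neg
        have hx : x ≤ ⌈x⌉₊ := Nat.le_ceil x
        calc γ * L ≤ x * ((β / a) ^ 2 / 2) := by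
              rw [le_div_iff₀ (by positivity)] at ha2
              rw [div_pow, div_div, mul_div_assoc', le_div_iff₀ (by positivity)]
              linarith
          _ ≤ _ := by gcongr

lemma surv_lower {c : ℝ} (hc0 : 0 < c) (hc : Real.pi ^ 2 / 8 < c ^ 2) :
    ∃ γ : ℝ, 0 < γ ∧ γ < 1 ∧ ∀ᶠ x : ℝ in atTop, ∀ n : ℕ, (n : ℝ) ≤ x → ∀ h : ℕ,
      2 * h ≤ ⌊c * Real.sqrt (x / Real.log (Real.log x))⌋₊ →
      (1 / 2) * Real.exp (-(γ * Real.log (Real.log x)))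
        ≤ spSurv ⌊c * Real.sqrt (x / Real.log (Real.log x))⌋₊ n h := by
  have hpi := Real.pi_pos
  obtain ⟨γ, hγ1, hγ2⟩ : ∃ γ, Real.pi ^ 2 / 8 / c ^ 2 < γ ∧ γ < 1 := by
    apply exists_between
    rw [div_lt_one (by positivity)]; exact hc
  have hγ0 : 0 < γ := lt_trans (by positivity) hγ1
  rw [div_lt_iff₀ (by positivity)] at hγ1
  refine ⟨γ, hγ0, hγ2, ?_⟩
  obtain ⟨e', he1, he2⟩ : ∃ e, 1 < e ∧ e < γ * c ^ 2 / (Real.pi ^ 2 / 8) := by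
    apply exists_between
    rw [lt_div_iff₀ (by positivity)]; linarith
  rw [lt_div_iff₀ (by positivity)] at he2
  obtain ⟨e, rfl⟩ : ∃ e, e' = 1 + e := ⟨e' - 1, by ring⟩
  have he : 0 < e := by linarith
  set q := (1 + e) * Real.pi ^ 2 / (8 * γ * c ^ 2) with hq
  have hq1 : q < 1 := by
    rw [hq, div_lt_one (by positivity)]; linarith
  have hy := tendsto_spScale hc0
  have hr : Tendsto (fun y : ℝ => ((⌊y⌋₊ : ℝ) / y) ^ 2) atTop (nhds (1 ^ 2)) :=
    (tendsto_nat_floor_div_atTop (R := ℝ)).pow 2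
  have hr' := hy.eventually (hr.eventually (le_mem_nhds (show q < (1 : ℝ) ^ 2 by simpa using hq1)))
  have hsmall : Tendsto (fun y : ℝ => (Real.pi / 2 / (⌊y⌋₊ : ℝ)) ^ 2 / 2 * (1 + e)) atTop
      (nhds (0 ^ 2 / 2 * (1 + e))) := by
    refine ((Tendsto.pow ?_ 2).div_const 2).mul_const _
    exact (tendsto_natCast_atTop_atTop.comp tendsto_nat_floor_atTop).const_div_atTop _
  have hsmall' := hy.eventually (hsmall.eventually
    (ge_mem_nhds (show (0 : ℝ) ^ 2 / 2 * (1 + e) < e by simpa using he)))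
  filter_upwards [hr', hsmall', hy.eventually_ge_atTop 1,
    tendsto_loglog.eventually_gt_atTop 0, eventually_gt_atTop 0] with x h1 h2 h3 h4 h5
  intro n hn h hh
  set L := Real.log (Real.log x) with hL
  set y := c * Real.sqrt (x / L) with hydef
  set a := ⌊y⌋₊ with ha
  have hy2 : y ^ 2 = c ^ 2 * (x / L) := by
    rw [hydef, mul_pow, Real.sq_sqrt (by positivity)]
  have ha0' : 0 < a := Nat.floor_pos.mpr h3
  have ha0 : (0 : ℝ) < a := by exact_mod_cast ha0'
  refine le_trans ?_ (le_spSurv a n ha0' h (by omega))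
  rw [mul_comm]
  have hhr : 2 * (h : ℝ) ≤ a := by exact_mod_cast hh
  have hcos2 : 1 / 2 ≤ Real.cos (Real.pi / 2 / a * h) := by
    rw [← Real.cos_pi_div_three]
    apply Real.cos_le_cos_of_nonneg_of_le_pi
    · positivity
    · linarith
    · rw [div_mul_eq_mul_div, div_le_iff₀ ha0]
      nlinarith
  have hcos1 := exp_neg_le_cos he h2
  have ha2 : (1 + e) * Real.pi ^ 2 * x / (8 * γ * L) ≤ (a : ℝ) ^ 2 := by
    rw [div_pow, le_div_iff₀ (by positivity), hy2, hq] at h1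
    refine le_trans (le_of_eq ?_) h1
    field_simp
  have hcos3 : Real.exp (-(γ * L)) ≤ Real.cos (Real.pi / 2 / a) ^ n := by
    refine le_trans ?_ (pow_le_pow_left₀ (Real.exp_pos _).le hcos1 n)
    rw [← Real.exp_nat_mul]
    apply Real.exp_le_exp.mpr
    have : (n : ℝ) * ((1 + e) * ((Real.pi / 2 / a) ^ 2 / 2)) ≤ γ * L := by
      calc (n : ℝ) * ((1 + e) * ((Real.pi / 2 / a) ^ 2 / 2))
          ≤ x * ((1 + e) * ((Real.pi / 2 / a) ^ 2 / 2)) := by gcongr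
        _ = (1 + e) * Real.pi ^ 2 * x / 8 / (a : ℝ) ^ 2 := by field_simp; ring
        _ ≤ γ * L := by
          rw [div_le_iff₀ (by positivity)]
          rw [div_le_iff₀ (by positivity)] at ha2
          linarith
    linarith
  exact mul_le_mul hcos3 hcos2 (by norm_num) (le_trans (Real.exp_pos _).le hcos3)

/-! ### The lower half -/

section Halves

variable {K : ℕ} {Ω : Type} [MeasurableSpace Ω] {P : Measure Ω} {W : ℕ → Ω → SpiderV K}

lemma summable_surv {c ρ : ℝ} (hc0 : 0 < c) (hc : c ^ 2 < Real.pi ^ 2 / 8) (hρ : 1 < ρ) :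
    Summable (fun k : ℕ => spSurv ⌈c * Real.sqrt (ρ ^ k / Real.log (Real.log (ρ ^ k)))⌉₊
      ⌈ρ ^ k⌉₊ 0) := by
  obtain ⟨γ, hγ, C, hC⟩ := surv_upper hc0 hc
  have hC' := (tendsto_pow_atTop_atTop_of_one_lt hρ).eventually hC
  have hs : Summable (fun k : ℕ => C * (Real.log ρ ^ (-γ) * (k : ℝ) ^ (-γ))) :=
    ((Real.summable_nat_rpow.mpr (by linarith)).mul_left _).mul_left _
  refine Summable.of_norm_bounded_eventually_nat hs ?_
  filter_upwards [hC', eventually_gt_atTop 0] with k hk hk0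
  rw [Real.norm_of_nonneg (spSurv_nonneg _ _ _)]
  refine hk.trans (le_of_eq ?_)
  have hl : 0 < Real.log ρ := Real.log_pos hρ
  have hk0' : (0 : ℝ) < k := by exact_mod_cast hk0
  rw [Real.log_pow, ← Real.mul_rpow hl.le hk0'.le, Real.rpow_def_of_pos (by positivity)]
  congr 2
  rw [mul_comm (k : ℝ)]; ring

lemma lower_half [IsProbabilityMeasure P] (hK : 1 ≤ K) (hmeas : ∀ n, Measurable (W n))
    (h0 : ∀ ω, W 0 ω = SpiderV.body)
    (hMarkov : ∀ n (h : ℕ → SpiderV K) (w : SpiderV K),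
      P ({ω | W (n + 1) ω = w} ∩ {ω | ∀ k ≤ n, W k ω = h k})
        = spiderKernel K (h n) w * P {ω | ∀ k ≤ n, W k ω = h k})
    {c : ℝ} (hc0 : 0 < c) (hc : c < Real.pi / Real.sqrt 8) :
    ∀ᵐ ω ∂P, ∀ᶠ n : ℕ in atTop, c ≤ Real.sqrt (Real.log (Real.log n) / n)
          * (((Finset.range (n + 1)).sup fun t => spiderHeight (W t ω) : ℕ) : ℝ) := by
  obtain ⟨c', hc1, hc2⟩ := exists_between hc
  have hc'0 : 0 < c' := hc0.trans hc1
  have hc'2 : c' ^ 2 < Real.pi ^ 2 / 8 := by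
    have := pow_lt_pow_left₀ hc2 hc'0.le two_ne_zero
    rwa [div_pow, Real.sq_sqrt (by norm_num)] at this
  set ρ := (c' / c) ^ 2 with hρdef
  have hρ : 1 < ρ := one_lt_pow₀ (by rwa [lt_div_iff₀ hc0, one_mul]) two_ne_zero
  have hsum := summable_surv hc'0 hc'2 hρ
  have hfin : ∑' k : ℕ, P (spStay W ⌈c' * Real.sqrt (ρ ^ k / Real.log (Real.log (ρ ^ k)))⌉₊ 0
      ⌈ρ ^ k⌉₊) ≠ ⊤ := by
    simp_rw [sp_stay_zero hK hmeas h0 hMarkov]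
    exact hsum.tsum_ofReal_ne_top
  filter_upwards [ae_eventually_notMem hfin] with ω hω
  have hpow := tendsto_pow_atTop_atTop_of_one_lt hρ
  have hLpos := hpow.eventually (tendsto_loglog.eventually_gt_atTop 0)
  have hlpos := hpow.eventually (Real.tendsto_log_atTop.eventually_gt_atTop 0)
  obtain ⟨k0, hk0⟩ := eventually_atTop.mp (hω.and (hLpos.and hlpos))
  have hn0 := tendsto_natCast_atTop_atTop (R := ℝ) |>.eventually_ge_atTop (ρ ^ k0)
  filter_upwards [hn0, eventually_ge_atTop 1] with n hn hn1
  have hn1' : (1 : ℝ) ≤ n := by exact_mod_cast hn1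
  obtain ⟨k, hk1, hk2⟩ := exists_nat_pow_near hn1' hρ
  have hkk : k0 ≤ k := by
    have := lt_of_le_of_lt hn hk2
    have := (pow_lt_pow_iff_right₀ hρ).mp this
    omega
  obtain ⟨hs, hL, hl⟩ := hk0 k hkk
  simp only [spStay, Set.mem_ofPred_eq, not_forall, not_lt] at hs
  obtain ⟨t, -, ht, hta⟩ := hs
  have htn : t ≤ n := by
    have : ⌈ρ ^ k⌉₊ ≤ n := Nat.ceil_le.mpr hk1
    omega
  have hM : t ∈ Finset.range (n + 1) := by simp; omega
  have hM2 := Finset.le_sup (f := fun t => spiderHeight (W t ω)) hM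
  have hM3 := hta.trans hM2
  set M := (Finset.range (n + 1)).sup fun t => spiderHeight (W t ω) with hMdef
  have hM4 : c' * Real.sqrt (ρ ^ k / Real.log (Real.log (ρ ^ k))) ≤ M := Nat.ceil_le.mp hM3
  have hρ0 : 0 < ρ := by linarith
  have hρk : 0 < ρ ^ k := by positivity
  have hLn : Real.log (Real.log (ρ ^ k)) ≤ Real.log (Real.log n) := by
    apply Real.log_le_log hl
    exact Real.log_le_log hρk hk1
  set L := Real.log (Real.log (ρ ^ k)) with hLdef
  have hsq : Real.sqrt (L / ρ ^ (k + 1)) ≤ Real.sqrt (Real.log (Real.log n) / n) := by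
    apply Real.sqrt_le_sqrt
    gcongr
    exact hL.le.trans hLn
  calc c = Real.sqrt (L / ρ ^ (k + 1)) * (c' * Real.sqrt (ρ ^ k / L)) := by
        rw [mul_left_comm, ← Real.sqrt_mul (by positivity)]
        have : L / ρ ^ (k + 1) * (ρ ^ k / L) = (c / c') ^ 2 := by
          have : L / ρ ^ (k + 1) * (ρ ^ k / L) = 1 / ρ := by
            rw [pow_succ]; field_simp
          rw [this, hρdef]; field_simp
        rw [this, Real.sqrt_sq (by positivity)]
        field_simp
    _ ≤ _ := by gcongr

/-! ### The upper half -/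

/-- The fast growing sequence of times. -/
def spN (k : ℕ) : ℕ := k.factorial ^ 2

lemma spN_succ (k : ℕ) : spN (k + 1) = (k + 1) ^ 2 * spN k := by
  simp [spN, Nat.factorial_succ, mul_pow]

lemma spN_pos (k : ℕ) : 0 < spN k := by
  simp [spN, Nat.factorial_pos]

lemma le_spN (k : ℕ) : k ≤ spN k :=
  (Nat.self_le_factorial k).trans (Nat.le_self_pow two_ne_zero _)

lemma tendsto_spN : Tendsto (fun k => ((spN k : ℕ) : ℝ)) atTop atTop :=
  tendsto_natCast_atTop_atTop.comp (tendsto_atTop_mono le_spN tendsto_id)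

lemma spN_mono {k l : ℕ} (h : k ≤ l) : spN k ≤ spN l :=
  Nat.pow_le_pow_left (Nat.factorial_le h) 2

lemma log_spN_le (k : ℕ) : Real.log (spN k) ≤ 2 * (k * Real.log k) := by
  rw [spN, Nat.cast_pow, Real.log_pow]
  have h1 : (0 : ℝ) < (k.factorial : ℝ) := by exact_mod_cast Nat.factorial_pos k
  have h2 : Real.log (k.factorial : ℝ) ≤ Real.log ((k : ℝ) ^ k) := by
    apply Real.log_le_log h1
    exact_mod_cast Nat.factorial_le_pow k
  rw [Real.log_pow] at h2
  push_cast
  linarith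

lemma loglog_spN_le {γ : ℝ} (h0 : 0 < γ) (h1 : γ < 1) :
    ∀ᶠ k : ℕ in atTop, γ * Real.log (Real.log (spN k)) ≤ Real.log k := by
  have hpos : 0 < 1 / γ - 1 := by
    rw [sub_pos, lt_div_iff₀ h0]; linarith
  have ho := (isLittleO_log_rpow_atTop hpos).bound (show (0 : ℝ) < 1 / 2 by norm_num)
  have ho' := tendsto_natCast_atTop_atTop (R := ℝ) |>.eventually ho
  have hlog := tendsto_spN.eventually (Real.tendsto_log_atTop.eventually_gt_atTop 0)
  filter_upwards [ho', hlog, eventually_gt_atTop 1] with k hk hl hk1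
  have hk1' : (1 : ℝ) < k := by exact_mod_cast hk1
  have hk0 : (0 : ℝ) < k := by linarith
  rw [Real.norm_of_nonneg (Real.log_nonneg hk1'.le), Real.norm_of_nonneg (by positivity)] at hk
  have h2 : Real.log (spN k) ≤ (k : ℝ) ^ (1 / γ) := by
    refine (log_spN_le k).trans ?_
    have : (k : ℝ) ^ (1 / γ) = k * (k : ℝ) ^ (1 / γ - 1) := by
      rw [Real.rpow_sub_one hk0.ne']; field_simp
    rw [this]
    nlinarith
  have h3 := Real.log_le_log hl h2
  rw [Real.log_rpow hk0] at h3
  calc γ * Real.log (Real.log (spN k)) ≤ γ * (1 / γ * Real.log k) := by gcongr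
    _ = Real.log k := by field_simp

/-- Height threshold. -/
noncomputable def spA (c : ℝ) (k : ℕ) : ℕ :=
  ⌊c * Real.sqrt ((spN k : ℝ) / Real.log (Real.log (spN k)))⌋₊

lemma summable_compl {c : ℝ} (hc : 0 < c) :
    Summable (fun k : ℕ => 1 - spSurv (spA c (k + 1) / 2 + 1) (spN k) 0) := by
  have hs : Summable (fun k : ℕ => 16 / c ^ 2 * (((k + 1 : ℕ) : ℝ)) ^ (-(3 / 2) : ℝ)) :=
    ((summable_nat_add_iff 1).mpr (Real.summable_nat_rpow.mpr (by norm_num))).mul_left _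
  refine Summable.of_norm_bounded_eventually_nat hs ?_
  have hs1 := tendsto_add_atTop_nat 1
  have hL := hs1.eventually (loglog_spN_le (show (0 : ℝ) < 1 / 2 by norm_num) (by norm_num))
  have hLp := hs1.eventually (tendsto_spN.eventually (tendsto_loglog.eventually_gt_atTop 0))
  filter_upwards [hL, hLp] with k hk hp
  have hle1 : spSurv (spA c (k + 1) / 2 + 1) (spN k) 0 ≤ 1 := spSurv_le_one _ _ _
  rw [Real.norm_of_nonneg (by linarith)]
  refine (one_sub_spSurv_le _ _ (by omega) 0).trans ?_
  set L := Real.log (Real.log (spN (k + 1))) with hLdef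
  set y := c * Real.sqrt ((spN (k + 1) : ℝ) / L) with hy
  have hN0 : (0 : ℝ) < spN k := by exact_mod_cast spN_pos k
  have hN1 : (0 : ℝ) < spN (k + 1) := by exact_mod_cast spN_pos (k + 1)
  have hb : y / 2 ≤ ((spA c (k + 1) / 2 + 1 : ℕ) : ℝ) := by
    have h1 : y < (spA c (k + 1) : ℝ) + 1 := Nat.lt_floor_add_one y
    have h2 : spA c (k + 1) + 1 ≤ 2 * (spA c (k + 1) / 2 + 1) := by omega
    have h3 : ((spA c (k + 1) : ℝ) + 1) ≤ 2 * ((spA c (k + 1) / 2 + 1 : ℕ) : ℝ) := by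
      exact_mod_cast h2
    linarith
  have hk1 : (0 : ℝ) < ((k + 1 : ℕ) : ℝ) := by positivity
  have hLle : L ≤ 4 * ((k + 1 : ℕ) : ℝ) ^ (1 / 2 : ℝ) := by
    have := Real.log_le_rpow_div hk1.le (show (0 : ℝ) < 1 / 2 by norm_num)
    linarith
  have hy2 : (y / 2) ^ 2 = c ^ 2 * ((k + 1 : ℕ) : ℝ) ^ 2 * spN k / (4 * L) := by
    rw [div_pow, hy, mul_pow, Real.sq_sqrt (by positivity), spN_succ]
    push_cast; field_simp; norm_num
  have hy0 : 0 < y := by positivity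
  calc (((0 : ℕ) : ℝ) ^ 2 + spN k) / ((spA c (k + 1) / 2 + 1 : ℕ) : ℝ) ^ 2
      ≤ spN k / (y / 2) ^ 2 := by
        rw [Nat.cast_zero, zero_pow two_ne_zero, zero_add]
        gcongr
    _ = 4 / c ^ 2 * L / ((k + 1 : ℕ) : ℝ) ^ 2 := by
        rw [hy2]; field_simp
    _ ≤ 4 / c ^ 2 * (4 * ((k + 1 : ℕ) : ℝ) ^ (1 / 2 : ℝ)) / ((k + 1 : ℕ) : ℝ) ^ 2 := by gcongr
    _ = _ := by
        have : ((k + 1 : ℕ) : ℝ) ^ (-(3 / 2) : ℝ)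
            = ((k + 1 : ℕ) : ℝ) ^ (1 / 2 : ℝ) / ((k + 1 : ℕ) : ℝ) ^ 2 := by
          rw [← Real.rpow_natCast (((k + 1 : ℕ) : ℝ)) 2, ← Real.rpow_sub hk1]; norm_num
        rw [this]; ring

lemma spDet.inter {m : ℕ} {A B : Set Ω} (hA : spDet W m A) (hB : spDet W m B) :
    spDet W m (A ∩ B) := fun ω ω' h hω => ⟨hA ω ω' h hω.1, hB ω ω' h hω.2⟩

lemma spDet.compl {m : ℕ} {A : Set Ω} (hA : spDet W m A) : spDet W m Aᶜ :=
  fun ω ω' h hω hω' => hω (hA ω' ω (fun k hk => (h k hk).symm) hω')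

lemma spDet.mono {m m' : ℕ} {A : Set Ω} (hA : spDet W m A) (h : m ≤ m') : spDet W m' A :=
  fun ω ω' H => hA ω ω' (fun k hk => H k (hk.trans h))

lemma spDet_stay (a n : ℕ) : spDet W n (spStay W a 0 n) := by
  intro ω ω' h hω t h1 h2
  rw [← h t (by omega)]
  exact hω t h1 h2

/-- The event that from index `m` on, for `i` indices, the walk is not confined. -/
def spX (W : ℕ → Ω → SpiderV K) (c : ℝ) (m : ℕ) : ℕ → Set Ω
  | 0 => Set.univ
  | i + 1 => spX W c m i ∩ spStay W (spA c (m + i + 1) / 2 + 1) 0 (spN (m + i))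
      ∩ (spStay W (spA c (m + i + 1)) 0 (spN (m + i + 1)))ᶜ

lemma spDet_spX (c : ℝ) (m i : ℕ) : spDet W (spN (m + i)) (spX W c m i) := by
  induction i with
  | zero => intro ω ω' _ _; trivial
  | succ i ih =>
    exact ((ih.mono (spN_mono (by omega))).inter ((spDet_stay _ _).mono (spN_mono (by omega)))).inter
      ((spDet_stay _ _).compl)

lemma spX_step [IsProbabilityMeasure P] (hK : 1 ≤ K) (hmeas : ∀ n, Measurable (W n))
    (hMarkov : ∀ n (h : ℕ → SpiderV K) (w : SpiderV K),
      P ({ω | W (n + 1) ω = w} ∩ {ω | ∀ k ≤ n, W k ω = h k})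
        = spiderKernel K (h n) w * P {ω | ∀ k ≤ n, W k ω = h k})
    {c : ℝ} (hc0 : 0 < c) (hc : Real.pi ^ 2 / 8 < c ^ 2) :
    ∃ k0 : ℕ, ∀ m ≥ k0, ∀ i, P.real (spX W c m (i + 1))
      ≤ Real.exp (-(1 / 2 * (1 / ((m + i + 1 : ℕ) : ℝ)))) * P.real (spX W c m i) := by
  obtain ⟨γ, hγ0, hγ1, hev⟩ := surv_lower hc0 hc
  have hs1 := tendsto_add_atTop_nat 1
  have e1 := hs1.eventually (tendsto_spN.eventually hev)
  have e2 := hs1.eventually (loglog_spN_le hγ0 hγ1)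
  have e3 := hs1.eventually (tendsto_spN.eventually ((tendsto_spScale hc0).eventually_ge_atTop 2))
  obtain ⟨k0, hk0⟩ := eventually_atTop.mp (e1.and (e2.and e3))
  refine ⟨k0, fun m hm i => ?_⟩
  obtain ⟨H1, H2, H3⟩ := hk0 (m + i) (by omega)
  set k := m + i with hk
  set A := spX W c m i ∩ spStay W (spA c (k + 1) / 2 + 1) 0 (spN k) with hA
  have ha2 : 2 ≤ spA c (k + 1) := Nat.le_floor (by exact_mod_cast H3)
  have hAdet : spDet W (spN k) A := (spDet_spX c m i).inter (spDet_stay _ _)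
  have hNle : spN k ≤ spN (k + 1) := spN_mono (by omega)
  have hlow := sp_markov_lower hK hmeas hMarkov (spA c (k + 1)) (spN (k + 1) - spN k) (spN k)
    hAdet (p := 1 / 2 * (1 / ((k + 1 : ℕ) : ℝ))) (by
      intro ω hω
      have hh := hω.2 (spN k) (Nat.zero_le _) (by omega)
      have := H1 (spN (k + 1) - spN k) (by exact_mod_cast Nat.sub_le _ _)
        (spiderHeight (W (spN k) ω)) (show _ ≤ spA c (k + 1) by omega)
      refine le_trans ?_ this
      gcongr
      have hk1 : (0 : ℝ) < ((k + 1 : ℕ) : ℝ) := by positivity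
      rw [one_div, ← Real.exp_log hk1, ← Real.exp_neg]
      exact Real.exp_le_exp.mpr (neg_le_neg H2))
  have hsub : A ∩ spStay W (spA c (k + 1)) (spN k) (spN (k + 1) - spN k)
      ⊆ A ∩ spStay W (spA c (k + 1)) 0 (spN (k + 1)) := by
    rintro ω ⟨hω1, hω2⟩
    refine ⟨hω1, fun t _ ht => ?_⟩
    rcases le_total t (spN k) with h | h
    · have := hω1.2 t (Nat.zero_le _) (by omega)
      omega
    · exact hω2 t h (by omega)
  have hlow2 := hlow.trans (measure_mono hsub)
  have hlow3 : 1 / 2 * (1 / ((k + 1 : ℕ) : ℝ)) * P.real A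
      ≤ P.real (A ∩ spStay W (spA c (k + 1)) 0 (spN (k + 1))) := by
    have := ENNReal.toReal_mono (measure_ne_top _ _) hlow2
    rwa [ENNReal.toReal_mul, ENNReal.toReal_ofReal (by positivity)] at this
  have hsplit := measureReal_inter_add_sdiff (μ := P) (s := A)
    (spStay_meas hmeas (spA c (k + 1)) 0 (spN (k + 1)))
  have hX : spX W c m (i + 1) = A \ spStay W (spA c (k + 1)) 0 (spN (k + 1)) := rfl
  have hmono : P.real A ≤ P.real (spX W c m i) := measureReal_mono Set.inter_subset_left
  have hexp := Real.add_one_le_exp (-(1 / 2 * (1 / ((k + 1 : ℕ) : ℝ))))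
  rw [hX]
  calc P.real (A \ spStay W (spA c (k + 1)) 0 (spN (k + 1)))
      ≤ (-(1 / 2 * (1 / ((k + 1 : ℕ) : ℝ))) + 1) * P.real A := by linarith
    _ ≤ Real.exp (-(1 / 2 * (1 / ((k + 1 : ℕ) : ℝ)))) * P.real A := by gcongr
    _ ≤ _ := by gcongr

lemma spX_null [IsProbabilityMeasure P] {c : ℝ} {m : ℕ} (h : ∀ i, P.real (spX W c m (i + 1))
      ≤ Real.exp (-(1 / 2 * (1 / ((m + i + 1 : ℕ) : ℝ)))) * P.real (spX W c m i)) :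
    P (⋂ i, spX W c m i) = 0 := by
  have h1 : ∀ i, P.real (spX W c m i)
      ≤ Real.exp (-(1 / 2 * ∑ j ∈ Finset.range i, 1 / ((j + (m + 1) : ℕ) : ℝ))) := by
    intro i
    induction i with
    | zero => simp
    | succ i ih =>
      refine (h i).trans ?_
      refine (mul_le_mul_of_nonneg_left ih (Real.exp_pos _).le).trans (le_of_eq ?_)
      rw [← Real.exp_add, Finset.sum_range_succ]
      have : i + (m + 1) = m + i + 1 := by ring
      rw [this]
      congr 1; ring
  have h2 : Tendsto (fun i => ∑ j ∈ Finset.range i, 1 / ((j + (m + 1) : ℕ) : ℝ)) atTop atTop := by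
    rw [← not_summable_iff_tendsto_nat_atTop_of_nonneg (fun j => by positivity)]
    rw [summable_nat_add_iff (f := fun n : ℕ => 1 / (n : ℝ))]
    exact Real.not_summable_one_div_natCast
  have h3 : Tendsto (fun i => Real.exp (-(1 / 2 * ∑ j ∈ Finset.range i,
      1 / ((j + (m + 1) : ℕ) : ℝ)))) atTop (nhds 0) :=
    Real.tendsto_exp_neg_atTop_nhds_zero.comp (h2.const_mul_atTop (by norm_num))
  have h4 : P.real (⋂ i, spX W c m i) ≤ 0 :=
    ge_of_tendsto' h3 fun i => (measureReal_mono (Set.iInter_subset _ i)).trans (h1 i)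
  have h5 := le_antisymm h4 measureReal_nonneg
  rwa [measureReal_eq_zero_iff] at h5

lemma upper_half [IsProbabilityMeasure P] (hK : 1 ≤ K) (hmeas : ∀ n, Measurable (W n))
    (h0 : ∀ ω, W 0 ω = SpiderV.body)
    (hMarkov : ∀ n (h : ℕ → SpiderV K) (w : SpiderV K),
      P ({ω | W (n + 1) ω = w} ∩ {ω | ∀ k ≤ n, W k ω = h k})
        = spiderKernel K (h n) w * P {ω | ∀ k ≤ n, W k ω = h k})
    {c : ℝ} (hc : Real.pi / Real.sqrt 8 < c) :
    ∀ᵐ ω ∂P, ∃ᶠ n : ℕ in atTop, Real.sqrt (Real.log (Real.log n) / n)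
          * (((Finset.range (n + 1)).sup fun t => spiderHeight (W t ω) : ℕ) : ℝ) ≤ c := by
  have hpi := Real.pi_pos
  have hc0 : 0 < c := lt_trans (by positivity) hc
  have hc2 : Real.pi ^ 2 / 8 < c ^ 2 := by
    have := pow_lt_pow_left₀ hc (by positivity) two_ne_zero
    rwa [div_pow, Real.sq_sqrt (by norm_num)] at this
  obtain ⟨k0, hk0⟩ := spX_step (P := P) hK hmeas hMarkov hc0 hc2
  have hnull : ∀ᵐ ω ∂P, ∀ m, k0 ≤ m → ω ∉ ⋂ i, spX W c m i := by
    rw [ae_all_iff]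
    intro m
    by_cases hm : k0 ≤ m
    · have := measure_eq_zero_iff_ae_notMem.mp (spX_null (hk0 m hm))
      filter_upwards [this] with ω hω _ using hω
    · exact Eventually.of_forall fun ω h => absurd h hm
  have hfin : ∑' k : ℕ, P (spStay W (spA c (k + 1) / 2 + 1) 0 (spN k))ᶜ ≠ ⊤ := by
    have : ∀ k : ℕ, P (spStay W (spA c (k + 1) / 2 + 1) 0 (spN k))ᶜ
        = ENNReal.ofReal (1 - spSurv (spA c (k + 1) / 2 + 1) (spN k) 0) := by
      intro k
      rw [prob_compl_eq_one_sub (spStay_meas hmeas _ _ _), sp_stay_zero hK hmeas h0 hMarkov,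
        ENNReal.ofReal_sub _ (spSurv_nonneg _ _ _), ENNReal.ofReal_one]
    simp_rw [this]
    exact (summable_compl hc0).tsum_ofReal_ne_top
  filter_upwards [hnull, ae_eventually_notMem hfin] with ω hω1 hω2
  have hfreq : ∃ᶠ k in atTop, ω ∈ spStay W (spA c (k + 1)) 0 (spN (k + 1)) := by
    intro hcon
    obtain ⟨m, hm⟩ := eventually_atTop.mp (hcon.and (hω2.and (eventually_ge_atTop k0)))
    refine hω1 m (hm m le_rfl).2.2 (Set.mem_iInter.mpr fun i => ?_)
    induction i with
    | zero => trivial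
    | succ i ih =>
      obtain ⟨g1, g2, -⟩ := hm (m + i) (by omega)
      exact ⟨⟨ih, by simpa using g2⟩, g1⟩
  have hs1 := tendsto_add_atTop_nat 1
  have hLp := hs1.eventually (tendsto_spN.eventually (tendsto_loglog.eventually_gt_atTop 0))
  have htend : Tendsto (fun k => spN (k + 1)) atTop atTop :=
    (tendsto_atTop_mono le_spN tendsto_id).comp hs1
  refine htend.frequently ((hfreq.and_eventually hLp).mono ?_)
  rintro k ⟨hk, hL⟩
  have hN1 : (0 : ℝ) < spN (k + 1) := by exact_mod_cast spN_pos (k + 1)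
  set L := Real.log (Real.log (spN (k + 1))) with hLdef
  have hM : (Finset.range (spN (k + 1) + 1)).sup (fun t => spiderHeight (W t ω))
      ≤ spA c (k + 1) := by
    apply Finset.sup_le
    intro t ht
    have := hk t (Nat.zero_le _) (by simp at ht; omega)
    exact this.le
  have hM2 : (((Finset.range (spN (k + 1) + 1)).sup (fun t => spiderHeight (W t ω)) : ℕ) : ℝ)
      ≤ c * Real.sqrt ((spN (k + 1) : ℝ) / L) :=
    le_trans (by exact_mod_cast hM) (Nat.floor_le (by positivity))
  calc _ ≤ Real.sqrt (L / spN (k + 1)) * (c * Real.sqrt ((spN (k + 1) : ℝ) / L)) := by gcongr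
    _ = c := by
      rw [mul_left_comm, ← Real.sqrt_mul (by positivity)]
      have : L / spN (k + 1) * ((spN (k + 1) : ℝ) / L) = 1 := by field_simp
      rw [this]; simp

end Halves

/-- For the spider `SP(K)` with a fixed number `K` of legs, almost surely
`liminf ((log log n)/n)^{1/2} · M_K(n) = π/√8`, where `M_K(n)` is the maximal height
reached on any leg in the first `n` steps. -/
theorem spider_max_height_liminf
    (K : ℕ) (hK : 1 ≤ K)
    (Ω : Type) [MeasurableSpace Ω] (P : Measure Ω) [IsProbabilityMeasure P]
    (W : ℕ → Ω → SpiderV K)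
    (hmeas : ∀ n, Measurable (W n))
    (h0 : ∀ ω, W 0 ω = SpiderV.body)
    (hMarkov : ∀ n (h : ℕ → SpiderV K) (w : SpiderV K),
      P ({ω | W (n + 1) ω = w} ∩ {ω | ∀ k ≤ n, W k ω = h k})
        = spiderKernel K (h n) w * P {ω | ∀ k ≤ n, W k ω = h k}) :
    ∀ᵐ ω ∂P, Filter.liminf (fun n : ℕ =>
        Real.sqrt (Real.log (Real.log n) / n)
          * (((Finset.range (n + 1)).sup fun t => spiderHeight (W t ω) : ℕ) : ℝ)) atTop
      = Real.pi / Real.sqrt 8 := by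
  have hpi := Real.pi_pos
  have hp : 0 < Real.pi / Real.sqrt 8 := by positivity
  have h1 : ∀ᵐ ω ∂P, ∀ q : ℚ, 0 < (q : ℝ) → (q : ℝ) < Real.pi / Real.sqrt 8 →
      ∀ᶠ n : ℕ in atTop, (q : ℝ) ≤ Real.sqrt (Real.log (Real.log n) / n)
          * (((Finset.range (n + 1)).sup fun t => spiderHeight (W t ω) : ℕ) : ℝ) := by
    rw [ae_all_iff]
    intro q
    by_cases hq : 0 < (q : ℝ) ∧ (q : ℝ) < Real.pi / Real.sqrt 8
    · filter_upwards [lower_half hK hmeas h0 hMarkov hq.1 hq.2] with ω hω _ _ using hω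
    · exact Eventually.of_forall fun ω g1 g2 => absurd ⟨g1, g2⟩ hq
  have h2 : ∀ᵐ ω ∂P, ∀ q : ℚ, Real.pi / Real.sqrt 8 < (q : ℝ) →
      ∃ᶠ n : ℕ in atTop, Real.sqrt (Real.log (Real.log n) / n)
          * (((Finset.range (n + 1)).sup fun t => spiderHeight (W t ω) : ℕ) : ℝ) ≤ (q : ℝ) := by
    rw [ae_all_iff]
    intro q
    by_cases hq : Real.pi / Real.sqrt 8 < (q : ℝ)
    · filter_upwards [upper_half hK hmeas h0 hMarkov hq] with ω hω _ using hω
    · exact Eventually.of_forall fun ω g1 => absurd g1 hq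
  filter_upwards [h1, h2] with ω g1 g2
  have hbdd : IsBoundedUnder (· ≥ ·) atTop (fun n : ℕ =>
        Real.sqrt (Real.log (Real.log n) / n)
          * (((Finset.range (n + 1)).sup fun t => spiderHeight (W t ω) : ℕ) : ℝ)) :=
    isBoundedUnder_of ⟨0, fun n => by positivity⟩
  apply le_antisymm
  · refine le_of_forall_gt_imp_ge_of_dense fun b hb => ?_
    obtain ⟨q, hq1, hq2⟩ := exists_rat_btwn hb
    exact (liminf_le_of_frequently_le (g2 q hq1) hbdd).trans hq2.le
  · obtain ⟨q', hq', -⟩ := exists_rat_btwn (lt_add_one (Real.pi / Real.sqrt 8))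
    have hcob := IsCoboundedUnder.of_frequently_le (g2 q' hq')
    refine le_of_forall_lt_imp_le_of_dense fun b hb => ?_
    obtain ⟨q, hq1, hq2⟩ := exists_rat_btwn (max_lt hb hp)
    exact ((le_max_left b 0).trans hq1.le).trans
      (le_liminf_of_le hcob (g1 q (lt_of_le_of_lt (le_max_right b 0) hq1) hq2))
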